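/- For λ ∈ ℝⁿ, any index h, and k > l ≥ 1 with λ ∈ Γ_k, set α = 1/(k−l). Then for any vector of 'third derivatives' (u_{pph})_p ∈ ℝⁿ: −(σ_k^{pp,qq}/σ_k)·Σ_{p,q} u_{pph} u_{qqh} + (σ_l^{pp,qq}/σ_l)·Σ_{p,q} u_{pph} u_{qqh} ≥ (T_k − T_l)·((α−1)T_k − (α+1)T_l), where T_k = (Σ_p σ_k^{pp} u_{pph})/σ_k and T_l = (Σ_p σ_l^{pp} u_{pph})/σ_l, and σ_m^{pp,qq} = ∂²σ_m/∂λ_p∂λ_q evaluated at λ. -/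

import Mathlib

/-- The `m`-th elementary symmetric polynomial of `x : Fin n → ℝ`. -/
noncomputable def esymm (n m : ℕ) (x : Fin n → ℝ) : ℝ :=
  ∑ s ∈ Finset.powersetCard m (Finset.univ : Finset (Fin n)), ∏ i ∈ s, x i

/-- The `m`-th elementary symmetric polynomial of the entries of `x` with indices in `s`. -/
noncomputable def esymmRes (n : ℕ) (s : Finset (Fin n)) (m : ℕ) (x : Fin n → ℝ) : ℝ :=
  ∑ t ∈ Finset.powersetCard m s, ∏ i ∈ t, x i

/-- First partial derivative `σ_m^{pp} = ∂σ_m/∂λ_p = σ_{m−1}(λ|p)`. -/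
noncomputable def sigmaP (n m : ℕ) (x : Fin n → ℝ) (p : Fin n) : ℝ :=
  esymmRes n ({p} : Finset (Fin n))ᶜ (m - 1) x

/-- Second partial derivative `σ_m^{pp,qq} = ∂²σ_m/∂λ_p∂λ_q`, which equals
`σ_{m−2}(λ|pq)` for `p ≠ q` and vanishes for `p = q` or `m < 2`. -/
noncomputable def sigmaPQ (n m : ℕ) (x : Fin n → ℝ) (p q : Fin n) : ℝ :=
  if p = q ∨ m < 2 then 0 else esymmRes n ({p, q} : Finset (Fin n))ᶜ (m - 2) x

open Finset in
/-- The sum of the products of `x` over the `m`-element subsets of `s`. -/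
def esymmOn {ι R : Type*} [CommRing R] (s : Finset ι) (m : ℕ) (x : ι → R) : R :=
  ∑ t ∈ powersetCard m s, ∏ i ∈ t, x i

namespace Polynomial

theorem Splits.derivative_real {p : ℝ[X]} (hp : p.Splits) : (derivative p).Splits := by
  rw [splits_iff_card_roots] at hp ⊢
  have h₁ := card_roots_le_derivative p
  have h₂ := card_roots' (derivative p)
  have h₃ := natDegree_derivative_le p
  by_cases h : p.natDegree = 0
  · rw [derivative_of_natDegree_zero h]
    simp
  · omega

theorem Splits.two_mul_coeff_zero_mul_coeff_two_le {p : ℝ[X]} (hp : p.Splits) :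
    2 * (p.coeff 0 * p.coeff 2) ≤ p.coeff 1 ^ 2 := by
  rw [hp.eq_prod_roots]
  suffices h : ∀ t : Multiset ℝ, 2 * ((t.map (X - C ·)).prod.coeff 0 *
      (t.map (X - C ·)).prod.coeff 2) ≤ (t.map (X - C ·)).prod.coeff 1 ^ 2 by
    simp only [coeff_C_mul]
    nlinarith [mul_le_mul_of_nonneg_left (h p.roots) (sq_nonneg p.leadingCoeff)]
  intro t
  induction t using Multiset.induction with
  | empty => simp [coeff_one]
  | cons a t ih =>
    simp only [Multiset.map_cons, Multiset.prod_cons, sub_mul, coeff_sub, coeff_C_mul,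
      coeff_X_mul, coeff_X_mul_zero]
    nlinarith [mul_le_mul_of_nonneg_left ih (sq_nonneg a),
      sq_nonneg ((t.map (X - C ·)).prod.coeff 0)]

theorem Splits.newton_inequality {p : ℝ[X]} (hp : p.Splits) (j : ℕ) :
    (j + 2) * (p.coeff j * p.coeff (j + 2)) ≤ (j + 1) * p.coeff (j + 1) ^ 2 := by
  induction j generalizing p with
  | zero => simpa using hp.two_mul_coeff_zero_mul_coeff_two_le
  | succ j ih =>
    have h := ih hp.derivative_real
    simp only [coeff_derivative] at h
    push_cast at h ⊢
    have hpos : (0 : ℝ) < (j + 1) * (j + 2) := by positivity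
    refine le_of_mul_le_mul_left ?_ hpos
    ring_nf at h ⊢
    linarith

theorem Splits.coeff_mul_coeff_le_sq {p : ℝ[X]} (hp : p.Splits) (j : ℕ) :
    p.coeff j * p.coeff (j + 2) ≤ p.coeff (j + 1) ^ 2 := by
  have h := hp.newton_inequality j
  have hj : (0 : ℝ) ≤ j := j.cast_nonneg
  by_contra! hlt
  nlinarith [sq_nonneg (p.coeff (j + 1))]

/-- The coefficient of `X ^ 2` in the power series `N / D`. -/
noncomputable def quotCoeffTwo (N D : ℝ[X]) : ℝ :=
  N.coeff 2 / D.coeff 0 - N.coeff 1 * D.coeff 1 / D.coeff 0 ^ 2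
    + N.coeff 0 * D.coeff 1 ^ 2 / D.coeff 0 ^ 3 - N.coeff 0 * D.coeff 2 / D.coeff 0 ^ 2

theorem quotCoeffTwo_sum {ι : Type*} (s : Finset ι) (N : ι → ℝ[X]) (D : ℝ[X]) :
    quotCoeffTwo (∑ i ∈ s, N i) D = ∑ i ∈ s, quotCoeffTwo (N i) D := by
  simp only [quotCoeffTwo, finsetSum_coeff, Finset.sum_add_distrib, Finset.sum_sub_distrib,
    Finset.sum_mul, Finset.sum_div]

theorem quotCoeffTwo_natCast_mul (c : ℕ) (N D : ℝ[X]) :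
    quotCoeffTwo (c * N) D = c * quotCoeffTwo N D := by
  simp only [quotCoeffTwo, coeff_natCast_mul]
  ring

theorem coeff_mul_two {R : Type*} [Semiring R] (p q : R[X]) :
    (p * q).coeff 2 = p.coeff 0 * q.coeff 2 + p.coeff 1 * q.coeff 1 + p.coeff 2 * q.coeff 0 := by
  simp [coeff_mul, Finset.Nat.antidiagonal_succ, add_assoc]

/-- With `q = b / a`, the quotient `x * b / (x * a + b)` equals `x - x ^ 2 / (x + q)`, which is
concave and increasing in `q`. -/
theorem quotCoeffTwo_mul_add_nonpos {x a b : ℝ[X]} (hx : x.coeff 2 = 0) (ha : 0 < a.coeff 0)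
    (hD : 0 < (b + x * a).coeff 0) (hq : quotCoeffTwo b a ≤ 0) :
    quotCoeffTwo (x * b) (b + x * a) ≤ 0 := by
  simp only [coeff_add, mul_coeff_zero] at hD
  have key : quotCoeffTwo (x * b) (b + x * a) =
      x.coeff 0 ^ 2 * a.coeff 0 ^ 2 / (b.coeff 0 + x.coeff 0 * a.coeff 0) ^ 2 * quotCoeffTwo b a -
      (x.coeff 1 * a.coeff 0 * b.coeff 0 - x.coeff 0 * a.coeff 0 * b.coeff 1
        + x.coeff 0 * a.coeff 1 * b.coeff 0) ^ 2
        / ((b.coeff 0 + x.coeff 0 * a.coeff 0) ^ 3 * a.coeff 0) := by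
    simp only [quotCoeffTwo, coeff_add, mul_coeff_zero, mul_coeff_one, coeff_mul_two, hx]
    have hD' := hD.ne'
    have ha' := ha.ne'
    field_simp
    ring
  rw [key]
  have h₁ : 0 ≤ x.coeff 0 ^ 2 * a.coeff 0 ^ 2 / (b.coeff 0 + x.coeff 0 * a.coeff 0) ^ 2 := by
    positivity
  have h₂ : 0 ≤ (x.coeff 1 * a.coeff 0 * b.coeff 0 - x.coeff 0 * a.coeff 0 * b.coeff 1
        + x.coeff 0 * a.coeff 1 * b.coeff 0) ^ 2
        / ((b.coeff 0 + x.coeff 0 * a.coeff 0) ^ 3 * a.coeff 0) := by positivity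
  linarith [mul_nonpos_of_nonneg_of_nonpos h₁ hq]

end Polynomial

section esymmOn

open Finset

variable {ι R : Type*} [CommRing R]

@[simp]
theorem esymmOn_zero (s : Finset ι) (x : ι → R) : esymmOn s 0 x = 1 := by
  simp [esymmOn]

@[simp]
theorem esymmOn_one (s : Finset ι) (x : ι → R) : esymmOn s 1 x = ∑ i ∈ s, x i := by
  simp [esymmOn, powersetCard_one]

theorem map_esymmOn {S : Type*} [CommRing S] (f : R →+* S) (s : Finset ι) (m : ℕ) (x : ι → R) :
    f (esymmOn s m x) = esymmOn s m (fun i => f (x i)) := by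
  simp [esymmOn]

theorem coeff_zero_esymmOn (s : Finset ι) (m : ℕ) (x : ι → Polynomial R) :
    (esymmOn s m x).coeff 0 = esymmOn s m (fun i => (x i).coeff 0) :=
  map_esymmOn Polynomial.constantCoeff s m x

theorem esymmOn_eq_zero {s : Finset ι} {m : ℕ} (h : #s < m) (x : ι → R) :
    esymmOn s m x = 0 := by
  simp [esymmOn, powersetCard_eq_empty.2 h]

theorem esymmOn_mul_esymmOn_le_sq (s : Finset ι) (m : ℕ) (x : ι → ℝ) :
    esymmOn s m x * esymmOn s (m + 2) x ≤ esymmOn s (m + 1) x ^ 2 := by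
  rcases lt_or_ge #s (m + 2) with h | h
  · rw [esymmOn_eq_zero h]
    simp [sq_nonneg]
  · have hsplits : (∏ i ∈ s, (Polynomial.X + Polynomial.C (x i))).Splits :=
      Polynomial.Splits.prod fun i _ => Polynomial.Splits.X_add_C (x i)
    have hcoeff : ∀ j ≤ #s, (∏ i ∈ s, (Polynomial.X + Polynomial.C (x i))).coeff (#s - j) =
        esymmOn s j x := fun j hj => by
      rw [Finset.prod_X_add_C_coeff s x (Nat.sub_le _ _), Nat.sub_sub_self hj, esymmOn]
    have hN := hsplits.coeff_mul_coeff_le_sq (#s - (m + 2))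
    rw [show #s - (m + 2) + 2 = #s - m by omega, show #s - (m + 2) + 1 = #s - (m + 1) by omega,
      hcoeff _ h, hcoeff _ (by omega), hcoeff _ (by omega)] at hN
    linarith

variable [DecidableEq ι]

theorem esymmOn_succ {s : Finset ι} {i : ι} (hi : i ∈ s) (m : ℕ) (x : ι → R) :
    esymmOn s (m + 1) x = esymmOn (s.erase i) (m + 1) x + x i * esymmOn (s.erase i) m x := by
  have hi' := notMem_erase i s
  have hmem : ∀ {j : ℕ} {t : Finset ι}, t ∈ powersetCard j (s.erase i) → i ∉ t := fun ht hit =>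
    hi' ((mem_powersetCard.1 ht).1 hit)
  conv_lhs => rw [← insert_erase hi]
  simp only [esymmOn]
  rw [powersetCard_succ_insert hi', sum_union, sum_image, mul_sum]
  · congr 1
    exact sum_congr rfl fun t ht => prod_insert (hmem ht)
  · intro t ht t' ht' h
    rw [← erase_insert (hmem ht), ← erase_insert (hmem ht'), h]
  · rw [disjoint_right]
    intro t ht ht'
    obtain ⟨t, -, rfl⟩ := mem_image.1 ht
    exact hmem ht' (mem_insert_self i t)

/-- Double counting of the pairs of an `(m + 1)`-element subset and one of its elements. -/
theorem sum_powersetCard_succ_sum_erase (s : Finset ι) (m : ℕ) (f x : ι → R) :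
    ∑ t ∈ powersetCard (m + 1) s, ∑ i ∈ t, f i * ∏ j ∈ t.erase i, x j =
      ∑ i ∈ s, f i * esymmOn (s.erase i) m x := by
  simp only [esymmOn, mul_sum]
  rw [sum_sigma', sum_sigma']
  refine sum_bij' (fun a _ => ⟨a.2, a.1.erase a.2⟩) (fun a _ => ⟨insert a.1 a.2, a.1⟩) ?_ ?_ ?_ ?_ ?_
  · rintro ⟨t, i⟩ h
    simp only [mem_sigma, mem_powersetCard] at h ⊢
    exact ⟨h.1.1 h.2, erase_subset_erase i h.1.1, by rw [card_erase_of_mem h.2, h.1.2]; rfl⟩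
  · rintro ⟨i, t⟩ h
    simp only [mem_sigma, mem_powersetCard] at h ⊢
    have hi : i ∉ t := fun hi => notMem_erase i s (h.2.1 hi)
    refine ⟨⟨insert_subset h.1 (h.2.1.trans (erase_subset i s)), ?_⟩, mem_insert_self i t⟩
    rw [card_insert_of_notMem hi, h.2.2]
  · rintro ⟨t, i⟩ h
    simp only [mem_sigma] at h
    simp [insert_erase h.2]
  · rintro ⟨i, t⟩ h
    simp only [mem_sigma, mem_powersetCard] at h
    have hi : i ∉ t := fun hi => notMem_erase i s (h.2.1 hi)
    simp [erase_insert hi]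
  · intros
    rfl

theorem succ_mul_esymmOn (s : Finset ι) (m : ℕ) (x : ι → R) :
    ((m + 1 : ℕ) : R) * esymmOn s (m + 1) x = ∑ i ∈ s, x i * esymmOn (s.erase i) m x := by
  rw [← sum_powersetCard_succ_sum_erase, esymmOn, mul_sum]
  refine sum_congr rfl fun t ht => ?_
  rw [sum_congr rfl fun i hi => mul_prod_erase t x hi, sum_const, (mem_powersetCard.1 ht).2,
    nsmul_eq_mul]

theorem derivative_esymmOn (s : Finset ι) (m : ℕ) (x : ι → Polynomial R) :
    Polynomial.derivative (esymmOn s (m + 1) x) =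
      ∑ i ∈ s, Polynomial.derivative (x i) * esymmOn (s.erase i) m x := by
  rw [← sum_powersetCard_succ_sum_erase, esymmOn, Polynomial.derivative_sum]
  refine sum_congr rfl fun t _ => ?_
  rw [Polynomial.derivative_prod_finset]
  exact sum_congr rfl fun i _ => mul_comm _ _

/-- Removing an entry maps the Gårding cone `Γ_k` to `Γ_{k-1}`. -/
theorem esymmOn_erase_pos {s : Finset ι} {i : ι} (hi : i ∈ s) {k : ℕ} {x : ι → ℝ}
    (h : ∀ m ≤ k, 0 < esymmOn s m x) : ∀ m < k, 0 < esymmOn (s.erase i) m x := by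
  intro m
  induction m with
  | zero => simp
  | succ m ih =>
    intro hm
    have ha := ih (by omega)
    have h₁ := h (m + 1) (by omega)
    have h₂ := h (m + 2) (by omega)
    rw [esymmOn_succ hi] at h₁ h₂
    have hN := esymmOn_mul_esymmOn_le_sq (s.erase i) m x
    by_contra! hb
    generalize esymmOn (s.erase i) m x = a at *
    generalize esymmOn (s.erase i) (m + 1) x = b at *
    generalize esymmOn (s.erase i) (m + 2) x = c at *
    have hac : a * (-(x i * b)) < a * c := mul_lt_mul_of_pos_left (by linarith) ha
    have hbb : (-b) * (-b) ≤ (x i * a) * (-b) :=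
      mul_le_mul_of_nonneg_right (by linarith) (by linarith)
    nlinarith

/-- The quotient `σ_{m+1} / σ_m` is concave on `Γ_m`, infinitesimally. -/
theorem quotCoeffTwo_esymmOn_nonpos (x : ι → Polynomial ℝ) (hx : ∀ i, (x i).coeff 2 = 0) (m : ℕ)
    (s : Finset ι) (h : ∀ j ≤ m, 0 < (esymmOn s j x).coeff 0) :
    Polynomial.quotCoeffTwo (esymmOn s (m + 1) x) (esymmOn s m x) ≤ 0 := by
  induction m generalizing s with
  | zero => simp [Polynomial.quotCoeffTwo, Polynomial.coeff_one, hx]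
  | succ m ih =>
    have hsum : ((m + 1 + 1 : ℕ) : ℝ) * Polynomial.quotCoeffTwo (esymmOn s (m + 1 + 1) x)
        (esymmOn s (m + 1) x) ≤ 0 := by
      rw [← Polynomial.quotCoeffTwo_natCast_mul, succ_mul_esymmOn, Polynomial.quotCoeffTwo_sum]
      refine sum_nonpos fun i hi => ?_
      have hpos : ∀ j < m + 1, 0 < (esymmOn (s.erase i) j x).coeff 0 := by
        simp only [coeff_zero_esymmOn] at h ⊢
        exact esymmOn_erase_pos hi h
      have hD := h (m + 1) le_rfl
      rw [esymmOn_succ hi] at hD ⊢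
      exact Polynomial.quotCoeffTwo_mul_add_nonpos (hx i) (hpos m (by omega)) hD
        (ih (s.erase i) fun j hj => hpos j (by omega))
    exact nonpos_of_mul_nonpos_right hsum (by positivity)

end esymmOn

theorem sub_le_sq_sub_sq_of_forall_succ {T R : ℕ → ℝ} {l d : ℕ} (hd : 0 < d)
    (h : ∀ m, l ≤ m → m < l + d →
      R (m + 1) - R m ≤ T (m + 1) ^ 2 - T m ^ 2 - (T (m + 1) - T m) ^ 2) :
    R (l + d) - R l ≤ T (l + d) ^ 2 - T l ^ 2 - (T (l + d) - T l) ^ 2 / d := by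
  have hcs := sq_sum_le_card_mul_sum_sq (s := Finset.range d)
    (f := fun i => T (l + (i + 1)) - T (l + i))
  have hsum := Finset.sum_le_sum fun i (hi : i ∈ Finset.range d) =>
    h (l + i) (by omega) (by have := Finset.mem_range.1 hi; omega)
  simp only [add_assoc] at hsum
  rw [Finset.sum_range_sub (fun i => R (l + i)), Finset.sum_sub_distrib,
    Finset.sum_range_sub (fun i => T (l + i) ^ 2)] at hsum
  rw [Finset.sum_range_sub (fun i => T (l + i)), Finset.card_range] at hcs
  have hd' : (0 : ℝ) < d := by exact_mod_cast hd
  rw [← div_le_iff₀' hd'] at hcs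
  simp only [add_zero] at hsum hcs
  linarith

section partialDerivatives

open Polynomial Finset

variable {n : ℕ} (x u : Fin n → ℝ)

theorem coeff_zero_esymmOn_affine (s : Finset (Fin n)) (m : ℕ) :
    (esymmOn s m fun i => C (x i) + C (u i) * X).coeff 0 = esymmRes n s m x := by
  rw [coeff_zero_esymmOn]
  simp [esymmOn, esymmRes]

theorem sum_sigmaP_mul {m : ℕ} (hm : 1 ≤ m) :
    ∑ p : Fin n, sigmaP n m x p * u p =
      (esymmOn univ m fun i => C (x i) + C (u i) * X).coeff 1 := by
  obtain ⟨m, rfl⟩ := Nat.exists_eq_add_of_le' hm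
  have h := congrArg (coeff · 0) (derivative_esymmOn univ m fun i => C (x i) + C (u i) * X)
  simp only [coeff_derivative, finsetSum_coeff, derivative_add, derivative_C, derivative_mul,
    derivative_X, zero_mul, zero_add, mul_one, coeff_C_mul, coeff_zero_esymmOn_affine] at h
  norm_num at h
  rw [h]
  refine sum_congr rfl fun p _ => ?_
  rw [sigmaP, compl_singleton, mul_comm, Nat.add_sub_cancel]

theorem sum_sigmaPQ_mul {m : ℕ} (hm : 1 ≤ m) :
    ∑ p : Fin n, ∑ q : Fin n, sigmaPQ n m x p q * u p * u q =
      2 * (esymmOn univ m fun i => C (x i) + C (u i) * X).coeff 2 := by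
  obtain rfl | ⟨m, rfl⟩ : m = 1 ∨ ∃ j, m = j + 2 := by
    rcases hm.eq_or_lt with h | h
    · exact .inl h.symm
    · exact .inr (Nat.exists_eq_add_of_le' h)
  · simp [sigmaPQ]
  have h : 2 * (esymmOn univ (m + 2) fun i => C (x i) + C (u i) * X).coeff 2 =
      (derivative (derivative (esymmOn univ (m + 2) fun i => C (x i) + C (u i) * X))).coeff 0 := by
    rw [coeff_derivative, coeff_derivative]
    norm_num
    ring
  rw [h, derivative_esymmOn]
  simp only [finsetSum_coeff, derivative_add, derivative_C, derivative_mul, derivative_X,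
    derivative_sum, derivative_esymmOn, zero_mul, zero_add, mul_one, coeff_C_mul,
    coeff_zero_esymmOn_affine]
  refine sum_congr rfl fun p _ => ?_
  rw [← sum_erase_add univ _ (mem_univ p), mul_sum]
  simp only [sigmaPQ, true_or, if_true, zero_mul, add_zero]
  refine sum_congr rfl fun q hq => ?_
  have hpq : ¬(p = q ∨ m + 2 < 2) := by
    have := ne_of_mem_erase hq
    rintro (h | h)
    · exact this h.symm
    · omega
  rw [if_neg hpq, show ({p, q} : Finset (Fin n))ᶜ = (univ.erase p).erase q by ext; simp; tauto,
    Nat.add_sub_cancel]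
  ring

end partialDerivatives

theorem stmt18 (n k l : ℕ) (hl : 1 ≤ l) (hlk : l < k) (hkn : k ≤ n)
    (lam : Fin n → ℝ)
    (hGamma : ∀ m, 1 ≤ m → m ≤ k → 0 < esymm n m lam)
    (u : Fin n → ℝ)  -- the vector of third derivatives `(u_{pph})_p`
    (α : ℝ) (hα : α = 1 / ((k : ℝ) - l)) :
    -(∑ p : Fin n, ∑ q : Fin n, sigmaPQ n k lam p q * u p * u q) / esymm n k lam
        + (∑ p : Fin n, ∑ q : Fin n, sigmaPQ n l lam p q * u p * u q) / esymm n l lam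
      ≥ ((∑ p : Fin n, sigmaP n k lam p * u p) / esymm n k lam
            - (∑ p : Fin n, sigmaP n l lam p * u p) / esymm n l lam)
          * ((α - 1) * ((∑ p : Fin n, sigmaP n k lam p * u p) / esymm n k lam)
            - (α + 1) * ((∑ p : Fin n, sigmaP n l lam p * u p) / esymm n l lam)) := by
  set F : ℕ → Polynomial ℝ := fun m =>
    esymmOn Finset.univ m fun i => Polynomial.C (lam i) + Polynomial.C (u i) * Polynomial.X with hF
  have hcoeff : ∀ m, (F m).coeff 0 = esymm n m lam := fun m =>
    coeff_zero_esymmOn_affine lam u Finset.univ m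
  have hpos : ∀ m ≤ k, 0 < (F m).coeff 0 := by
    intro m hm
    rcases Nat.eq_zero_or_pos m with rfl | h
    · simp [hF]
    · rw [hcoeff]
      exact hGamma m h hm
  have hstep : ∀ m, l ≤ m → m < l + (k - l) →
      2 * (F (m + 1)).coeff 2 / (F (m + 1)).coeff 0 - 2 * (F m).coeff 2 / (F m).coeff 0 ≤
        ((F (m + 1)).coeff 1 / (F (m + 1)).coeff 0) ^ 2 - ((F m).coeff 1 / (F m).coeff 0) ^ 2
          - ((F (m + 1)).coeff 1 / (F (m + 1)).coeff 0 - (F m).coeff 1 / (F m).coeff 0) ^ 2 := by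
    intro m _ hmk
    have hq : Polynomial.quotCoeffTwo (F (m + 1)) (F m) ≤ 0 :=
      quotCoeffTwo_esymmOn_nonpos _ (fun i => by simp) m _
        fun j hj => hpos j (by omega)
    have hN := hpos (m + 1) (by omega)
    have hD := hpos m (by omega)
    have hfac := mul_nonpos_of_nonneg_of_nonpos
      (div_nonneg (mul_nonneg zero_le_two hD.le) hN.le) hq
    rw [← sub_nonpos]
    refine le_of_eq_of_le ?_ hfac
    rw [Polynomial.quotCoeffTwo]
    field_simp
    ring
  have hmain := sub_le_sq_sub_sq_of_forall_succ (T := fun m => (F m).coeff 1 / (F m).coeff 0)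
    (R := fun m => 2 * (F m).coeff 2 / (F m).coeff 0) (Nat.sub_pos_of_lt hlk) hstep
  rw [Nat.add_sub_cancel' hlk.le, Nat.cast_sub hlk.le] at hmain
  rw [sum_sigmaPQ_mul lam u (hl.trans hlk.le), sum_sigmaPQ_mul lam u hl,
    sum_sigmaP_mul lam u (hl.trans hlk.le), sum_sigmaP_mul lam u hl, ← hcoeff, ← hcoeff, hα,
    ge_iff_le, ← sub_nonneg]
  refine (sub_nonneg.2 hmain).trans_eq ?_
  simp only [hF]
  ring
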